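/- Let f be a nonzero polynomial in n variables x₁,…,x_n over a commutative ring, of total degree at most d, and let μ := μ(f) be its monomial-weight. Then the cardinality of the cone of f satisfies 𝔰(f) := |𝒮(f)| ≤ C(n+1, μ) · C(d+μ, μ), where C(a,b) denotes the binomial coefficient. -/

import Mathlib

theorem Nat.sum_range_succ_multichoose (m d : ℕ) :
    ∑ k ∈ Finset.range (d + 1), m.multichoose k = (m + 1).multichoose d := by
  induction d with
  | zero => simp
  | succ d ih => rw [Finset.sum_range_succ, ih, Nat.multichoose_succ_succ, add_comm]

/-- There are at most `C(d + |T|, |T|)` exponent vectors supported in `T` of degree at most `d`. -/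
theorem Finset.card_biUnion_finsuppAntidiag_le {ι : Type*} [DecidableEq ι] (T : Finset ι) (d : ℕ) :
    ((Finset.range (d + 1)).biUnion fun k => T.finsuppAntidiag k).card ≤
      (d + T.card).choose T.card := by
  refine Finset.card_biUnion_le.trans_eq ?_
  simp_rw [Finset.card_finsuppAntidiag_nat_eq_multichoose]
  rw [Nat.sum_range_succ_multichoose, Nat.multichoose_eq, Nat.add_right_comm, Nat.add_sub_cancel,
    add_comm d, Nat.choose_symm_add]

/-- **Cone lemma.** For a nonzero `n`-variate polynomial `f` of total degree at most `d`
and monomial-weight `μ`, the cone `𝒮(f) = {e' | ∃ e ∈ S(f), e' ≤ e}` is finite and its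
cardinality is at most `C(n+1, μ) · C(d+μ, μ)`. -/
theorem cone_card_le {R : Type*} [CommRing R] (n d : ℕ) (f : MvPolynomial (Fin n) R)
    (hf : f ≠ 0) (hd : f.totalDegree ≤ d)
    (μ : ℕ) (hμ : μ = f.support.sup fun e => e.support.card) :
    {e' : Fin n →₀ ℕ | ∃ e ∈ f.support, e' ≤ e}.Finite ∧
    {e' : Fin n →₀ ℕ | ∃ e ∈ f.support, e' ≤ e}.ncard ≤
      Nat.choose (n + 1) μ * Nat.choose (d + μ) μ := by
  have hμn : μ ≤ n := by
    rw [hμ]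
    exact Finset.sup_le fun e _ => (Finset.card_le_univ _).trans_eq (Fintype.card_fin n)
  set B : Finset (Fin n →₀ ℕ) := (Finset.powersetCard μ Finset.univ).biUnion fun T =>
    (Finset.range (d + 1)).biUnion fun k => T.finsuppAntidiag k with hB
  have hsub : {e' : Fin n →₀ ℕ | ∃ e ∈ f.support, e' ≤ e} ⊆ (B : Set (Fin n →₀ ℕ)) := by
    rintro e' ⟨e, he, hle⟩
    have hcard : e.support.card ≤ μ := by
      rw [hμ]
      exact Finset.le_sup (f := fun e : Fin n →₀ ℕ => e.support.card) he
    obtain ⟨T, heT, hT⟩ := Finset.exists_superset_card_eq hcard (by simpa using hμn)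
    have hdeg : ∑ i ∈ T, e' i ≤ d := calc
      ∑ i ∈ T, e' i ≤ ∑ i ∈ T, e i := Finset.sum_le_sum fun i _ => hle i
      _ = e.sum fun _ k => k := (Finset.sum_subset heT fun i _ hi => by simpa using hi).symm
      _ ≤ d := (MvPolynomial.le_totalDegree he).trans hd
    simp only [hB, Finset.mem_coe, Finset.mem_biUnion, Finset.mem_powersetCard_univ,
      Finset.mem_range, Finset.mem_finsuppAntidiag]
    exact ⟨T, hT, _, Nat.lt_succ_of_le hdeg, rfl, (Finsupp.support_mono hle).trans heT⟩
  refine ⟨B.finite_toSet.subset hsub, ?_⟩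
  calc _ ≤ (B : Set (Fin n →₀ ℕ)).ncard := Set.ncard_le_ncard hsub B.finite_toSet
    _ = B.card := Set.ncard_coe_finset B
    _ ≤ (Finset.powersetCard μ (Finset.univ : Finset (Fin n))).card * (d + μ).choose μ :=
      Finset.card_biUnion_le_card_mul _ _ _ fun T hT => by
        simpa only [Finset.mem_powersetCard_univ.mp hT] using
          Finset.card_biUnion_finsuppAntidiag_le T d
    _ ≤ _ := by
      rw [Finset.card_powersetCard, Finset.card_fin]
      exact Nat.mul_le_mul_right _ (Nat.choose_le_choose μ n.le_succ)
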